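/- There is an isomorphism of k-algebras CliffordAlgebra Q_hyp ≅ End_k(⋀V) between the Clifford algebra of the hyperbolic quadratic form on V × V* and the k-algebra of k-linear endomorphisms of the exterior algebra of V. -/

import Mathlib

namespace ExteriorAlgebra

variable {R M : Type*} [CommRing R] [AddCommGroup M] [Module R M]

/-- The creation operator `a ↦ x ∧ a` on the exterior algebra. -/
noncomputable def creation : M →ₗ[R] Module.End R (ExteriorAlgebra R M) :=
  (Algebra.lmul R (ExteriorAlgebra R M)).toLinearMap ∘ₗ ι R

/-- The annihilation operator on the exterior algebra, contracting with a linear form. -/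
noncomputable def annihilation : Module.Dual R M →ₗ[R] Module.End R (ExteriorAlgebra R M) :=
  CliffordAlgebra.contractLeft

@[simp]
theorem creation_apply (x : M) (a : ExteriorAlgebra R M) : creation x a = ι R x * a := rfl

@[simp]
theorem annihilation_one (f : Module.Dual R M) :
    annihilation f (1 : ExteriorAlgebra R M) = 0 :=
  CliffordAlgebra.contractLeft_one _ f

theorem annihilation_ι_mul (f : Module.Dual R M) (x : M) (a : ExteriorAlgebra R M) :
    annihilation f (ι R x * a) = f x • a - ι R x * annihilation f a :=
  CliffordAlgebra.contractLeft_ι_mul f x a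

theorem creation_mul_self (x : M) : creation (R := R) x * creation x = 0 := by
  refine LinearMap.ext fun a => ?_
  rw [Module.End.mul_apply, creation_apply, creation_apply, ← mul_assoc, ι_sq_zero, zero_mul,
    LinearMap.zero_apply]

theorem ι_mul_ι_mul (x y : M) (a : ExteriorAlgebra R M) :
    ι R x * (ι R y * a) = -(ι R y * (ι R x * a)) := by
  rw [← mul_assoc, eq_neg_of_add_eq_zero_left (ι_add_mul_swap x y), neg_mul, mul_assoc]

theorem annihilation_mul_self (f : Module.Dual R M) : annihilation f * annihilation f = 0 :=
  LinearMap.ext fun a => CliffordAlgebra.contractLeft_contractLeft f a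

theorem annihilation_mul_creation (f : Module.Dual R M) (x : M) :
    annihilation f * creation x = algebraMap R _ (f x) - creation x * annihilation f := by
  ext a
  simp [annihilation_ι_mul, Module.algebraMap_end_apply]

/-- Creation and annihilation operators together square to the hyperbolic quadratic form. -/
theorem creation_add_annihilation_sq (x : M) (f : Module.Dual R M) :
    (creation x + annihilation f) * (creation x + annihilation f) =
      algebraMap R (Module.End R (ExteriorAlgebra R M)) (f x) := by
  rw [mul_add, add_mul, add_mul, creation_mul_self, annihilation_mul_self,
    annihilation_mul_creation]
  abel

variable {I : Type*} (b : Module.Basis I R M)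

/-- The composite of the projections `annihilation (b.coord i) * creation (b i)` for `i` in a
list, which projects onto the products of basis vectors with indices outside the list. -/
noncomputable def projAway : List I → Module.End R (ExteriorAlgebra R M)
  | [] => 1
  | i :: l => projAway l * (annihilation (b.coord i) * creation (b i))

theorem commute_creation_number {i j : I} (h : i ≠ j) :
    Commute (creation (b i)) (annihilation (b.coord j) * creation (b j)) := by
  refine LinearMap.ext fun a => ?_
  simp only [Module.End.mul_apply, creation_apply, annihilation_ι_mul, Module.Basis.coord_apply,
    Module.Basis.repr_self, Finsupp.single_eq_same, Finsupp.single_eq_of_ne h.symm, one_smul,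
    zero_smul, mul_sub, zero_sub, mul_neg, sub_neg_eq_add]
  rw [ι_mul_ι_mul, sub_neg_eq_add]

theorem commute_creation_projAway {i : I} {l : List I} (h : i ∉ l) :
    Commute (creation (b i)) (projAway b l) := by
  induction l with
  | nil => exact Commute.one_right _
  | cons j l ih =>
    rw [List.mem_cons, not_or] at h
    exact (ih h.2).mul_right (commute_creation_number b h.1)

theorem projAway_mul_creation {i : I} {l : List I} (h : i ∈ l) :
    projAway b l * creation (b i) = 0 := by
  induction l with
  | nil => simp at h
  | cons j l ih =>
    rw [projAway]
    by_cases hij : i = j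
    · subst hij
      rw [mul_assoc, mul_assoc, creation_mul_self, mul_zero, mul_zero]
    · rw [mul_assoc, ← (commute_creation_number b hij).eq, ← mul_assoc,
        ih ((List.mem_cons.1 h).resolve_left hij), zero_mul]

theorem projAway_one (l : List I) : projAway b l 1 = 1 := by
  induction l with
  | nil => rfl
  | cons i l ih =>
    rw [projAway, Module.End.mul_apply, Module.End.mul_apply, creation_apply, annihilation_ι_mul]
    simp [ih]

/-- Removing one index from the list of `projAway`. -/
theorem projAway_eq_add {i : I} {l : List I} (h : i ∉ l) :
    projAway b l = projAway b (i :: l) +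
      creation (b i) * projAway b (i :: l) * annihilation (b.coord i) := by
  have hac : annihilation (b.coord i) * creation (b i) =
      1 - creation (b i) * annihilation (b.coord i) := by
    simp [annihilation_mul_creation]
  have h1 : annihilation (b.coord i) * creation (b i) * annihilation (b.coord i) =
      annihilation (b.coord i) := by
    rw [hac, sub_mul, one_mul, mul_assoc, annihilation_mul_self, mul_zero, sub_zero]
  have h2 : creation (b i) * projAway b (i :: l) * annihilation (b.coord i) =
      projAway b l * (creation (b i) * annihilation (b.coord i)) := by
    rw [projAway, ← mul_assoc, (commute_creation_projAway b h).eq, mul_assoc, mul_assoc, h1]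
  rw [h2, projAway, ← mul_add, hac, sub_add_cancel, mul_one]

/-- Projecting away from all basis vectors gives the augmentation. -/
theorem projAway_apply_of_forall_mem {l : List I} (hl : ∀ i, i ∈ l) (a : ExteriorAlgebra R M) :
    projAway b l a = algebraMap R _ (algebraMapInv a) := by
  have hzero (x : M) : projAway b l * creation x = 0 := by
    have : LinearMap.mulLeft R (projAway b l) ∘ₗ creation = 0 :=
      b.ext fun i => projAway_mul_creation b (hl i)
    exact LinearMap.congr_fun this x
  induction a using CliffordAlgebra.left_induction with
  | algebraMap r =>
    rw [algebraMap_leftInverse M r, Algebra.algebraMap_eq_smul_one, map_smul, projAway_one]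
  | add x y hx hy => simp only [map_add, hx, hy]
  | ι_mul a x _ =>
    have h : algebraMapInv (ι R x) = 0 := by simp [algebraMapInv]
    exact (LinearMap.congr_fun (hzero x) a).trans (by simp [map_mul, h])

/-- A subalgebra containing all creation and annihilation operators is everything. -/
theorem eq_top_of_creation_mem_of_annihilation_mem [Module.Free R M] [Module.Finite R M]
    (A : Subalgebra R (Module.End R (ExteriorAlgebra R M)))
    (hc : ∀ x, creation x ∈ A) (ha : ∀ f, annihilation f ∈ A) : A = ⊤ := by
  let b := Module.Free.chooseBasis R M
  have hmul (a : ExteriorAlgebra R M) : Algebra.lmul R _ a ∈ A := by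
    induction a using ExteriorAlgebra.induction with
    | algebraMap r => rw [AlgHom.commutes]; exact A.algebraMap_mem r
    | ι x => exact hc x
    | mul x y hx hy => rw [map_mul]; exact A.mul_mem hx hy
    | add x y hx hy => rw [map_add]; exact A.add_mem hx hy
  have hproj (l) : projAway b l ∈ A := by
    induction l with
    | nil => exact A.one_mem
    | cons i l ih => exact A.mul_mem ih (A.mul_mem (ha _) (hc _))
  have hfull (T) : T * projAway b Finset.univ.toList ∈ A := by
    convert A.mul_mem (hmul (T 1)) (hproj Finset.univ.toList) using 1
    ext a
    simp [projAway_apply_of_forall_mem b (l := Finset.univ.toList) (by simp),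
      Algebra.algebraMap_eq_smul_one]
  have hdown (l : List _) (hl : l.Nodup) (h : ∀ T, T * projAway b l ∈ A) :
      ∀ T, T * projAway b [] ∈ A := by
    induction l with
    | nil => exact h
    | cons i l ih =>
      rw [List.nodup_cons] at hl
      refine ih hl.2 fun T => ?_
      rw [projAway_eq_add b hl.1, mul_add, ← mul_assoc, ← mul_assoc]
      exact A.add_mem (h _) (A.mul_mem (h _) (ha _))
  refine eq_top_iff.2 fun T _ => ?_
  simpa [projAway] using hdown _ (Finset.nodup_toList _) hfull T

instance [Module.Free R M] [Module.Finite R M] : Module.Finite R (ExteriorAlgebra R M) := by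
  classical
  let : LinearOrder (Module.Free.ChooseBasisIndex R M) := linearOrderOfSTO WellOrderingRel
  exact Module.Finite.of_basis (Module.Free.chooseBasis R M).ExteriorAlgebra

instance [Module.Free R M] : Module.Free R (ExteriorAlgebra R M) := by
  classical
  let : LinearOrder (Module.Free.ChooseBasisIndex R M) := linearOrderOfSTO WellOrderingRel
  exact Module.Free.of_basis (Module.Free.chooseBasis R M).ExteriorAlgebra

theorem finrank_eq_two_pow [Nontrivial R] [Module.Free R M] [Module.Finite R M] :
    Module.finrank R (ExteriorAlgebra R M) = 2 ^ Module.finrank R M := by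
  classical
  let : LinearOrder (Module.Free.ChooseBasisIndex R M) := linearOrderOfSTO WellOrderingRel
  rw [Module.finrank_eq_card_basis (Module.Free.chooseBasis R M).ExteriorAlgebra,
    Fintype.card_finset, Module.finrank_eq_card_basis (Module.Free.chooseBasis R M)]

end ExteriorAlgebra

/-- The Clifford algebra of the hyperbolic quadratic form `Q(x, f) = f x` on `V × V*` is
isomorphic to the endomorphism algebra of the exterior algebra of `V`. -/
theorem clifford_hyperbolic_iso_end_exterior
    (k : Type*) [Field k] (hchar : (2 : k) ≠ 0)
    (V : Type*) [AddCommGroup V] [Module k V] [FiniteDimensional k V]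
    (Q : QuadraticForm k (V × Module.Dual k V))
    (hQ : ∀ (x : V) (f : Module.Dual k V), Q (x, f) = f x) :
    Nonempty (CliffordAlgebra Q ≃ₐ[k] Module.End k (ExteriorAlgebra k V)) := by
  let : Invertible (2 : k) := invertibleOfNonzero hchar
  let e := CliffordAlgebra.equivExterior Q
  have : FiniteDimensional k (CliffordAlgebra Q) := Module.Finite.equiv e.symm
  let φ : CliffordAlgebra Q →ₐ[k] Module.End k (ExteriorAlgebra k V) :=
    CliffordAlgebra.lift Q ⟨ExteriorAlgebra.creation.coprod ExteriorAlgebra.annihilation,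
      fun v => by
        rw [LinearMap.coprod_apply, ExteriorAlgebra.creation_add_annihilation_sq, ← hQ]⟩
  have hφ (x : V) (f : Module.Dual k V) : φ (CliffordAlgebra.ι Q (x, f)) =
      ExteriorAlgebra.creation x + ExteriorAlgebra.annihilation f := by
    simp [φ]
  have hsurj : Function.Surjective φ := by
    rw [← AlgHom.range_eq_top]
    refine ExteriorAlgebra.eq_top_of_creation_mem_of_annihilation_mem _ (fun x => ?_) fun f => ?_
    · exact ⟨CliffordAlgebra.ι Q (x, 0), (hφ x 0).trans (by simp)⟩
    · exact ⟨CliffordAlgebra.ι Q (0, f), (hφ 0 f).trans (by simp)⟩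
  have hrank : Module.finrank k (CliffordAlgebra Q) =
      Module.finrank k (Module.End k (ExteriorAlgebra k V)) := by
    rw [e.finrank_eq, ExteriorAlgebra.finrank_eq_two_pow, Module.finrank_linearMap,
      ExteriorAlgebra.finrank_eq_two_pow, Module.finrank_prod, Subspace.dual_finrank_eq, pow_add]
  have hinj : Function.Injective φ :=
    (LinearMap.injective_iff_surjective_of_finrank_eq_finrank (f := φ.toLinearMap) hrank).2 hsurj
  exact ⟨AlgEquiv.ofBijective φ ⟨hinj, hsurj⟩⟩
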